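/- Let d = 3, p = 5, let λ ∈ ℝ, σ > 0, 0 < κ < σ/6, and let V(x) = (1/2) Σ_{j=1}^3 ω_j² x_j² with ω_j ∈ ℝ. Let u be a classical compactly supported solution of the damped NLS on [0,∞). Then for all t ≥ 0, ‖∇u(t,·)‖_{L²}² + 2 ∫_{ℝ³} V(x)|u(t,x)|² dx ≤ 2 E_κ(0) + (7λ²/(24κ)) ‖u(0,·)‖_{L²}². -/

import Mathlib

open MeasureTheory

/-- Spatial partial derivative in direction `j` of a complex-valued function on `ℝ^d`. -/
noncomputable def sd {d : ℕ} (v : EuclideanSpace ℝ (Fin d) → ℂ) (j : Fin d)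
    (x : EuclideanSpace ℝ (Fin d)) : ℂ :=
  fderiv ℝ v x (EuclideanSpace.single j 1)

/-- Spatial Laplacian of a complex-valued function on `ℝ^d`. -/
noncomputable def lap {d : ℕ} (v : EuclideanSpace ℝ (Fin d) → ℂ)
    (x : EuclideanSpace ℝ (Fin d)) : ℂ :=
  ∑ j, sd (sd v j) j x

/-- A classical, compactly supported solution of the damped NLS
`i ∂_t u + (1/2) Δ u = V u + λ|u|²u − iσ|u|^{p−1}u` on `[0,∞)`:
`u` is `C^∞` on all of `ℝ × ℝ^d`, satisfies the equation for all `t ≥ 0` and all `x`,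
and vanishes outside a fixed compact set in space for all `t ≥ 0`. -/
def IsSol (d : ℕ) (p σ lam : ℝ) (V : EuclideanSpace ℝ (Fin d) → ℝ)
    (u : ℝ → EuclideanSpace ℝ (Fin d) → ℂ) : Prop :=
  ContDiff ℝ (⊤ : ℕ∞) (Function.uncurry u) ∧
  (∀ t ≥ (0 : ℝ), ∀ x,
    Complex.I * deriv (fun s => u s x) t + (1 / 2 : ℂ) * lap (u t) x
      = (V x : ℂ) * u t x + (lam : ℂ) * ((‖u t x‖ ^ 2 : ℝ) : ℂ) * u t x
        - Complex.I * (σ : ℂ) * ((‖u t x‖ ^ (p - 1) : ℝ) : ℂ) * u t x) ∧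
  ∃ K : Set (EuclideanSpace ℝ (Fin d)), IsCompact K ∧
    ∀ t ≥ (0 : ℝ), ∀ x, x ∉ K → u t x = 0

open Set Filter Topology

section DirectionalDerivative

variable {X F : Type*} [NormedAddCommGroup X] [NormedSpace ℝ X] [NormedAddCommGroup F]
  [NormedSpace ℝ F]

/-- The derivative of `f` in the constant direction `v`, as a function of the base point. -/
noncomputable def dirDeriv (v : X) (f : X → F) (z : X) : F := fderiv ℝ f z v

lemma contDiff_dirDeriv {f : X → F} (hf : ContDiff ℝ (⊤ : ℕ∞) f) (v : X) :
    ContDiff ℝ (⊤ : ℕ∞) (dirDeriv v f) :=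
  (hf.fderiv_right (m := (⊤ : ℕ∞)) (by simp)).clm_apply contDiff_const

lemma dirDeriv_comm {f : X → F} (hf : ContDiff ℝ (⊤ : ℕ∞) f) (v w z : X) :
    dirDeriv v (dirDeriv w f) z = dirDeriv w (dirDeriv v f) z := by
  have hd : DifferentiableAt ℝ (fderiv ℝ f) z :=
    (hf.fderiv_right (m := (⊤ : ℕ∞)) (by simp)).differentiable (by simp) z
  have key (p q : X) : dirDeriv p (dirDeriv q f) z = fderiv ℝ (fderiv ℝ f) z p q := by
    change fderiv ℝ (fun y => fderiv ℝ f y q) z p = _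
    rw [fderiv_clm_apply hd (differentiableAt_const q)]
    simp
  rw [key, key]
  exact (hf.contDiffAt.isSymmSndFDerivAt (by
    rw [minSmoothness_of_isRCLikeNormedField]
    exact WithTop.coe_le_coe.2 (le_top : (2 : ℕ∞) ≤ ⊤))) v w

lemma dirDeriv_clm_comp {G : Type*} [NormedAddCommGroup G] [NormedSpace ℝ G] {f : X → F}
    (hf : Differentiable ℝ f) (L : F →L[ℝ] G) (v z : X) :
    dirDeriv v (fun y => L (f y)) z = L (dirDeriv v f z) := by
  have h := (L.hasFDerivAt.comp z (hf z).hasFDerivAt).fderiv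
  simp only [dirDeriv]
  change fderiv ℝ (L ∘ f) z v = _
  rw [h]; rfl

lemma hasDerivAt_comp_line {f : X → F} (hf : Differentiable ℝ f) (v z : X) :
    HasDerivAt (fun s : ℝ => f (z + s • v)) (dirDeriv v f z) 0 := by
  have hl : HasDerivAt (fun s : ℝ => z + s • v) v 0 := by
    simpa using ((hasDerivAt_id (0 : ℝ)).smul_const v).const_add z
  have hf' : HasFDerivAt f (fderiv ℝ f z) (z + (0 : ℝ) • v) := by
    simpa using (hf z).hasFDerivAt
  exact hf'.comp_hasDerivAt 0 hl

end DirectionalDerivative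

section SpaceTime

variable {E F : Type*} [NormedAddCommGroup E] [NormedAddCommGroup F]

/-- `f` vanishes at all nonnegative times outside of the set `K`. -/
def VanishesOutside (K : Set E) (f : ℝ × E → F) : Prop :=
  ∀ z : ℝ × E, 0 ≤ z.1 → z.2 ∉ K → f z = 0

lemma VanishesOutside.integrable_slice [MeasurableSpace E] [BorelSpace E]
    {μ : Measure E} [IsFiniteMeasureOnCompacts μ] {K : Set E}
    (hK : IsCompact K) {f : ℝ × E → F} (hf : Continuous f) (h : VanishesOutside K f)
    {t : ℝ} (ht : 0 ≤ t) : Integrable (fun x => f (t, x)) μ :=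
  (hf.comp (by fun_prop : Continuous fun x : E => (t, x))).integrable_of_hasCompactSupport
    (HasCompactSupport.intro hK fun x hx => h (t, x) ht hx)

variable [NormedSpace ℝ E] [NormedSpace ℝ F]

lemma VanishesOutside.dirDeriv {K : Set E} (hK : IsClosed K) {f : ℝ × E → F}
    (hf : ContDiff ℝ (⊤ : ℕ∞) f) (h : VanishesOutside K f) (v : ℝ × E) :
    VanishesOutside K (dirDeriv v f) := by
  have hopen : Ioi (0 : ℝ) ×ˢ Kᶜ ⊆ {z | _root_.dirDeriv v f z = 0} := by
    intro z hz
    have he : f =ᶠ[𝓝 z] fun _ => 0 := by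
      filter_upwards [(isOpen_Ioi.prod hK.isOpen_compl).mem_nhds hz] with y hy
      exact h y (le_of_lt hy.1) hy.2
    simp [_root_.dirDeriv, he.fderiv_eq]
  have hcl : IsClosed {z | _root_.dirDeriv v f z = 0} :=
    isClosed_eq (contDiff_dirDeriv hf v).continuous continuous_const
  intro z hz0 hzK
  refine closure_minimal hopen hcl ?_
  rw [closure_prod_eq, closure_Ioi]
  exact ⟨hz0, subset_closure hzK⟩

lemma hasDerivAt_time {f : ℝ × E → F} (hf : Differentiable ℝ f) (t : ℝ) (x : E) :
    HasDerivAt (fun s => f (s, x)) (dirDeriv (1, 0) f (t, x)) t :=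
  (hf (t, x)).hasFDerivAt.comp_hasDerivAt t ((hasDerivAt_id t).prodMk (hasDerivAt_const t x))

lemma fderiv_slice {f : ℝ × E → F} (hf : Differentiable ℝ f) (t : ℝ) (x v : E) :
    fderiv ℝ (fun y => f (t, y)) x v = dirDeriv (0, v) f (t, x) := by
  have h : HasFDerivAt (fun y => f (t, y))
      ((fderiv ℝ f (t, x)).comp ((0 : E →L[ℝ] ℝ).prod (ContinuousLinearMap.id ℝ E))) x :=
    (hf (t, x)).hasFDerivAt.comp x ((hasFDerivAt_const t x).prodMk (hasFDerivAt_id x))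
  rw [h.fderiv]
  rfl

variable [MeasurableSpace E] [BorelSpace E] {μ : Measure E}

lemma VanishesOutside.integral_dirDeriv_space [FiniteDimensional ℝ E] [μ.IsAddHaarMeasure]
    {K : Set E} (hK : IsCompact K) {f : ℝ × E → ℝ} (hf : ContDiff ℝ (⊤ : ℕ∞) f)
    (h : VanishesOutside K f) (v : E) {t : ℝ} (ht : 0 ≤ t) :
    ∫ x, _root_.dirDeriv (0, v) f (t, x) ∂μ = 0 := by
  have hd : Differentiable ℝ f := hf.differentiable (by simp)
  have hs : Differentiable ℝ (fun y => f (t, y)) := by fun_prop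
  have hi := h.integrable_slice (μ := μ) hK hf.continuous ht
  have hi' := (h.dirDeriv hK.isClosed hf (0, v)).integrable_slice (μ := μ) hK
    (contDiff_dirDeriv hf _).continuous ht
  have key := integral_mul_fderiv_eq_neg_fderiv_mul_of_integrable (μ := μ) (𝕜 := ℝ)
    (f := fun _ : E => (1 : ℝ)) (g := fun y => f (t, y)) (v := v) (by simp)
    (by simpa [fderiv_slice hd] using hi') (by simpa using hi)
    (fun x _ => differentiableAt_const _) (fun x _ => hs x)
  simpa [fderiv_slice hd] using key

lemma VanishesOutside.hasDerivAt_integral [SecondCountableTopology E]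
    [IsFiniteMeasureOnCompacts μ] {K : Set E} (hK : IsCompact K) {f : ℝ × E → ℝ}
    (hf : ContDiff ℝ (⊤ : ℕ∞) f) (h : VanishesOutside K f) {t : ℝ} (ht : 0 < t) :
    HasDerivAt (fun s => ∫ x, f (s, x) ∂μ)
      (∫ x, _root_.dirDeriv (1, 0) f (t, x) ∂μ) t := by
  have hd : Differentiable ℝ f := hf.differentiable (by simp)
  have hc' := (contDiff_dirDeriv hf ((1, 0) : ℝ × E)).continuous
  have h' := h.dirDeriv hK.isClosed hf (1, 0)
  obtain ⟨C, hC⟩ := ((isCompact_Icc (a := t / 2) (b := 2 * t)).prod hK).exists_bound_of_continuousOn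
    hc'.continuousOn
  refine (hasDerivAt_integral_of_dominated_loc_of_deriv_le
    (F := fun s x => f (s, x)) (F' := fun s x => _root_.dirDeriv (1, 0) f (s, x))
    (s := Icc (t / 2) (2 * t)) (bound := K.indicator fun _ => C)
    (Icc_mem_nhds (by linarith) (by linarith)) ?_
    (h.integrable_slice hK hf.continuous ht.le)
    (h'.integrable_slice hK hc' ht.le).aestronglyMeasurable ?_ ?_ ?_).2
  · exact .of_forall fun s =>
      (hf.continuous.comp (by fun_prop : Continuous fun x : E => (s, x))).aestronglyMeasurable
  · refine .of_forall fun x s hs => ?_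
    by_cases hx : x ∈ K
    · simpa [hx] using hC (s, x) ⟨hs, hx⟩
    · simp [hx, h' (s, x) (by linarith [hs.1]) hx]
  · exact (integrableOn_const hK.measure_ne_top).integrable_indicator hK.isClosed.measurableSet
  · exact .of_forall fun x s _ => hasDerivAt_time hd s x

/-- If the time derivative of the density `f` is at most a spatial divergence, then the integral
of `f` over space is nonincreasing in time. -/
lemma VanishesOutside.antitoneOn_integral [FiniteDimensional ℝ E] [μ.IsAddHaarMeasure]
    {ι : Type*} [Fintype ι] {K : Set E} (hK : IsCompact K) {f : ℝ × E → ℝ} {J : ι → ℝ × E → ℝ}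
    (hf : ContDiff ℝ (⊤ : ℕ∞) f) (h : VanishesOutside K f)
    (hJ : ∀ j, ContDiff ℝ (⊤ : ℕ∞) (J j)) (hJ0 : ∀ j, VanishesOutside K (J j)) (v : ι → E)
    (hle : ∀ t x, 0 ≤ t → _root_.dirDeriv (1, 0) f (t, x)
      ≤ ∑ j, _root_.dirDeriv (0, v j) (J j) (t, x)) :
    AntitoneOn (fun t => ∫ x, f (t, x) ∂μ) (Ici 0) := by
  have hJi (j : ι) {t : ℝ} (ht : 0 ≤ t) :
      Integrable (fun x => _root_.dirDeriv (0, v j) (J j) (t, x)) μ :=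
    ((hJ0 j).dirDeriv hK.isClosed (hJ j) _).integrable_slice hK
      (contDiff_dirDeriv (hJ j) _).continuous ht
  refine antitoneOn_of_deriv_nonpos (convex_Ici 0) ?_ ?_ ?_
  · exact continuousOn_integral_of_compact_support (f := fun t x => f (t, x)) hK
      hf.continuous.continuousOn fun t x ht hx => h (t, x) ht hx
  · rw [interior_Ici]
    exact fun t ht =>
      (h.hasDerivAt_integral hK hf ht).differentiableAt.differentiableWithinAt
  · rw [interior_Ici]
    intro t ht
    have ht' : 0 ≤ t := le_of_lt ht
    rw [(h.hasDerivAt_integral hK hf ht).deriv]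
    calc ∫ x, _root_.dirDeriv (1, 0) f (t, x) ∂μ
        ≤ ∫ x, ∑ j, _root_.dirDeriv (0, v j) (J j) (t, x) ∂μ :=
          integral_mono ((h.dirDeriv hK.isClosed hf _).integrable_slice hK
            (contDiff_dirDeriv hf _).continuous ht')
            (integrable_finsetSum _ fun j _ => hJi j ht') fun x => hle t x ht'
      _ = 0 := by
          rw [integral_finsetSum _ fun j _ => hJi j ht']
          exact Finset.sum_eq_zero fun j _ => (hJ0 j).integral_dirDeriv_space hK (hJ j) (v j) ht'

end SpaceTime

section DampedNLS

variable {d : ℕ}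

/-- The unit vector of `ℝ × ℝ^d` in the `j`-th spatial direction. -/
noncomputable def spaceDir (j : Fin d) : ℝ × EuclideanSpace ℝ (Fin d) :=
  (0, EuclideanSpace.single j 1)

/-- The energy density of `a + i b` with quadratic weight `q`, i.e.
`(1/2)|∇(a + i b)|² + q|a + i b|² + (λ/2)|a + i b|⁴ + κ|a + i b|⁶`. -/
noncomputable def energyDensity (lam κ : ℝ) (q a b : ℝ × EuclideanSpace ℝ (Fin d) → ℝ)
    (z : ℝ × EuclideanSpace ℝ (Fin d)) : ℝ :=
  1 / 2 * ∑ j, (dirDeriv (spaceDir j) a z ^ 2 + dirDeriv (spaceDir j) b z ^ 2)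
    + q z * (a z ^ 2 + b z ^ 2) + lam / 2 * (a z ^ 2 + b z ^ 2) ^ 2
    + κ * (a z ^ 2 + b z ^ 2) ^ 3

/-- The `j`-th component of the energy flux: for `u = a + i b`, this is
`Re(∂ₜū ∂ⱼu) + σ|u|⁴ Re(ū ∂ⱼu) - (3κ|u|⁴ + c) Im(ū ∂ⱼu)`. -/
noncomputable def energyFlux (σ κ c : ℝ) (a b : ℝ × EuclideanSpace ℝ (Fin d) → ℝ) (j : Fin d)
    (z : ℝ × EuclideanSpace ℝ (Fin d)) : ℝ :=
  dirDeriv (1, 0) a z * dirDeriv (spaceDir j) a z + dirDeriv (1, 0) b z * dirDeriv (spaceDir j) b z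
    + σ * (a z ^ 2 + b z ^ 2) ^ 2 *
      (a z * dirDeriv (spaceDir j) a z + b z * dirDeriv (spaceDir j) b z)
    - (3 * κ * (a z ^ 2 + b z ^ 2) ^ 2 + c) *
      (a z * dirDeriv (spaceDir j) b z - b z * dirDeriv (spaceDir j) a z)

variable {lam σ κ c : ℝ} {q a b : ℝ × EuclideanSpace ℝ (Fin d) → ℝ}

lemma contDiff_energyDensity (hq : ContDiff ℝ (⊤ : ℕ∞) q) (ha : ContDiff ℝ (⊤ : ℕ∞) a)
    (hb : ContDiff ℝ (⊤ : ℕ∞) b) : ContDiff ℝ (⊤ : ℕ∞) (energyDensity lam κ q a b) := by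
  have ha' (j : Fin d) := contDiff_dirDeriv ha (spaceDir j)
  have hb' (j : Fin d) := contDiff_dirDeriv hb (spaceDir j)
  unfold energyDensity
  fun_prop

lemma contDiff_energyFlux (ha : ContDiff ℝ (⊤ : ℕ∞) a) (hb : ContDiff ℝ (⊤ : ℕ∞) b)
    (j : Fin d) : ContDiff ℝ (⊤ : ℕ∞) (energyFlux σ κ c a b j) := by
  have ha' := contDiff_dirDeriv ha (spaceDir j)
  have hb' := contDiff_dirDeriv hb (spaceDir j)
  have hat := contDiff_dirDeriv ha (1, 0)
  have hbt := contDiff_dirDeriv hb (1, 0)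
  unfold energyFlux
  fun_prop

lemma dirDeriv_time_energyDensity (hq : ContDiff ℝ (⊤ : ℕ∞) q) (ha : ContDiff ℝ (⊤ : ℕ∞) a)
    (hb : ContDiff ℝ (⊤ : ℕ∞) b) (z : ℝ × EuclideanSpace ℝ (Fin d))
    (hqt : dirDeriv (1, 0) q z = 0) :
    dirDeriv (1, 0) (energyDensity lam κ q a b) z =
      ∑ j, (dirDeriv (spaceDir j) a z * dirDeriv (1, 0) (dirDeriv (spaceDir j) a) z
        + dirDeriv (spaceDir j) b z * dirDeriv (1, 0) (dirDeriv (spaceDir j) b) z)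
      + (q z + lam * (a z ^ 2 + b z ^ 2) + 3 * κ * (a z ^ 2 + b z ^ 2) ^ 2)
        * (2 * (a z * dirDeriv (1, 0) a z + b z * dirDeriv (1, 0) b z)) := by
  have hline {f : ℝ × EuclideanSpace ℝ (Fin d) → ℝ} (hf : ContDiff ℝ (⊤ : ℕ∞) f) :=
    hasDerivAt_comp_line (hf.differentiable (by simp)) (1, 0) z
  have hρ := ((hline ha).fun_pow 2).fun_add ((hline hb).fun_pow 2)
  have hgrad := HasDerivAt.fun_sum (u := Finset.univ) fun (j : Fin d) _ =>
    ((hline (contDiff_dirDeriv ha (spaceDir j))).fun_pow 2).fun_add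
      ((hline (contDiff_dirDeriv hb (spaceDir j))).fun_pow 2)
  have h := (((hgrad.const_mul (1 / 2)).fun_add ((hline hq).fun_mul hρ)).fun_add
    ((hρ.fun_pow 2).const_mul (lam / 2))).fun_add ((hρ.fun_pow 3).const_mul κ)
  rw [(hline (contDiff_energyDensity hq ha hb)).unique h]
  simp only [zero_smul, add_zero, hqt, Finset.mul_sum]
  rw [add_assoc, add_assoc]
  congr 1
  · exact Finset.sum_congr rfl fun j _ => by push_cast; ring
  · push_cast; ring

lemma dirDeriv_space_energyFlux (ha : ContDiff ℝ (⊤ : ℕ∞) a) (hb : ContDiff ℝ (⊤ : ℕ∞) b)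
    (j : Fin d) (z : ℝ × EuclideanSpace ℝ (Fin d)) :
    dirDeriv (spaceDir j) (energyFlux σ κ c a b j) z =
      (dirDeriv (spaceDir j) a z * dirDeriv (1, 0) (dirDeriv (spaceDir j) a) z
        + dirDeriv (spaceDir j) b z * dirDeriv (1, 0) (dirDeriv (spaceDir j) b) z)
      + ((dirDeriv (1, 0) a z + σ * (a z ^ 2 + b z ^ 2) ^ 2 * a z
            + (3 * κ * (a z ^ 2 + b z ^ 2) ^ 2 + c) * b z)
          * dirDeriv (spaceDir j) (dirDeriv (spaceDir j) a) z
        + (dirDeriv (1, 0) b z + σ * (a z ^ 2 + b z ^ 2) ^ 2 * b z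
            - (3 * κ * (a z ^ 2 + b z ^ 2) ^ 2 + c) * a z)
          * dirDeriv (spaceDir j) (dirDeriv (spaceDir j) b) z)
      + (a z ^ 2 + b z ^ 2) *
        (5 * σ * (a z * dirDeriv (spaceDir j) a z + b z * dirDeriv (spaceDir j) b z) ^ 2
        + σ * (a z * dirDeriv (spaceDir j) b z - b z * dirDeriv (spaceDir j) a z) ^ 2
        - 12 * κ * (a z * dirDeriv (spaceDir j) a z + b z * dirDeriv (spaceDir j) b z)
          * (a z * dirDeriv (spaceDir j) b z - b z * dirDeriv (spaceDir j) a z)) := by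
  have hline {f : ℝ × EuclideanSpace ℝ (Fin d) → ℝ} (hf : ContDiff ℝ (⊤ : ℕ∞) f) :=
    hasDerivAt_comp_line (hf.differentiable (by simp)) (spaceDir j) z
  have hρ := ((hline ha).fun_pow 2).fun_add ((hline hb).fun_pow 2)
  have haj := hline (contDiff_dirDeriv ha (spaceDir j))
  have hbj := hline (contDiff_dirDeriv hb (spaceDir j))
  have h := ((((hline (contDiff_dirDeriv ha (1, 0))).fun_mul haj).fun_add
    ((hline (contDiff_dirDeriv hb (1, 0))).fun_mul hbj)).fun_add
    (((hρ.fun_pow 2).const_mul σ).fun_mul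
      (((hline ha).fun_mul haj).fun_add ((hline hb).fun_mul hbj)))).fun_sub
    ((((hρ.fun_pow 2).const_mul (3 * κ)).add_const c).fun_mul
      (((hline ha).fun_mul hbj).fun_sub ((hline hb).fun_mul haj)))
  rw [(hline (contDiff_energyFlux ha hb j)).unique h]
  simp only [zero_smul, add_zero, dirDeriv_comm ha (spaceDir j) (1, 0),
    dirDeriv_comm hb (spaceDir j) (1, 0)]
  push_cast
  ring

/-- The dissipation produced by the zeroth order terms of the damped equation. -/
lemma dissipation_nonpos {V A B At Bt LA LB : ℝ} (hσ : 0 < σ) (hκ : 0 < κ) (hV : 0 ≤ V)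
    (hAt : At = -(1 / 2) * LB + (V + lam * (A ^ 2 + B ^ 2)) * B - σ * (A ^ 2 + B ^ 2) ^ 2 * A)
    (hBt : Bt = 1 / 2 * LA - (V + lam * (A ^ 2 + B ^ 2)) * A - σ * (A ^ 2 + B ^ 2) ^ 2 * B) :
    (V + lam ^ 2 / (12 * κ) + lam * (A ^ 2 + B ^ 2) + 3 * κ * (A ^ 2 + B ^ 2) ^ 2)
        * (2 * (A * At + B * Bt))
      ≤ (At + σ * (A ^ 2 + B ^ 2) ^ 2 * A
            + (3 * κ * (A ^ 2 + B ^ 2) ^ 2 + lam ^ 2 / (12 * κ)) * B) * LA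
        + (Bt + σ * (A ^ 2 + B ^ 2) ^ 2 * B
            - (3 * κ * (A ^ 2 + B ^ 2) ^ 2 + lam ^ 2 / (12 * κ)) * A) * LB := by
  have key : (V + lam ^ 2 / (12 * κ) + lam * (A ^ 2 + B ^ 2) + 3 * κ * (A ^ 2 + B ^ 2) ^ 2)
        * (2 * (A * At + B * Bt))
      - ((At + σ * (A ^ 2 + B ^ 2) ^ 2 * A
            + (3 * κ * (A ^ 2 + B ^ 2) ^ 2 + lam ^ 2 / (12 * κ)) * B) * LA
        + (Bt + σ * (A ^ 2 + B ^ 2) ^ 2 * B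
            - (3 * κ * (A ^ 2 + B ^ 2) ^ 2 + lam ^ 2 / (12 * κ)) * A) * LB)
      = -(2 * σ * V * (A ^ 2 + B ^ 2) ^ 3
        + 6 * κ * σ * (A ^ 2 + B ^ 2) ^ 3 * (A ^ 2 + B ^ 2 + lam / (6 * κ)) ^ 2) := by
    rw [hAt, hBt]
    field_simp
    ring
  have : 0 ≤ 2 * σ * V * (A ^ 2 + B ^ 2) ^ 3
      + 6 * κ * σ * (A ^ 2 + B ^ 2) ^ 3 * (A ^ 2 + B ^ 2 + lam / (6 * κ)) ^ 2 := by positivity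
  linarith

/-- Local energy inequality for the damped equation, written for real and imaginary parts. -/
lemma dirDeriv_time_energyDensity_le {V : EuclideanSpace ℝ (Fin d) → ℝ} (hσ : 0 < σ) (hκ : 0 < κ)
    (hκσ : κ < σ / 6) (hV : ContDiff ℝ (⊤ : ℕ∞) V) (ha : ContDiff ℝ (⊤ : ℕ∞) a)
    (hb : ContDiff ℝ (⊤ : ℕ∞) b) (z : ℝ × EuclideanSpace ℝ (Fin d)) (hV0 : 0 ≤ V z.2)
    (hat : dirDeriv (1, 0) a z = -(1 / 2) * ∑ j, dirDeriv (spaceDir j) (dirDeriv (spaceDir j) b) z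
      + (V z.2 + lam * (a z ^ 2 + b z ^ 2)) * b z - σ * (a z ^ 2 + b z ^ 2) ^ 2 * a z)
    (hbt : dirDeriv (1, 0) b z = 1 / 2 * ∑ j, dirDeriv (spaceDir j) (dirDeriv (spaceDir j) a) z
      - (V z.2 + lam * (a z ^ 2 + b z ^ 2)) * a z - σ * (a z ^ 2 + b z ^ 2) ^ 2 * b z) :
    dirDeriv (1, 0) (energyDensity lam κ (fun y => V y.2 + lam ^ 2 / (12 * κ)) a b) z
      ≤ ∑ j, dirDeriv (spaceDir j) (energyFlux σ κ (lam ^ 2 / (12 * κ)) a b j) z := by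
  have hq : ContDiff ℝ (⊤ : ℕ∞)
      fun y : ℝ × EuclideanSpace ℝ (Fin d) => V y.2 + lam ^ 2 / (12 * κ) := by fun_prop
  have hqt : dirDeriv (1, 0)
      (fun y : ℝ × EuclideanSpace ℝ (Fin d) => V y.2 + lam ^ 2 / (12 * κ)) z = 0 :=
    (hasDerivAt_comp_line (hq.differentiable (by simp)) (1, 0) z).unique
      (by simpa using hasDerivAt_const (0 : ℝ) (V z.2))
  rw [dirDeriv_time_energyDensity hq ha hb z hqt]
  simp only [dirDeriv_space_energyFlux ha hb]
  have hquad : 0 ≤ ∑ j, (a z ^ 2 + b z ^ 2) *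
        (5 * σ * (a z * dirDeriv (spaceDir j) a z + b z * dirDeriv (spaceDir j) b z) ^ 2
        + σ * (a z * dirDeriv (spaceDir j) b z - b z * dirDeriv (spaceDir j) a z) ^ 2
        - 12 * κ * (a z * dirDeriv (spaceDir j) a z + b z * dirDeriv (spaceDir j) b z)
          * (a z * dirDeriv (spaceDir j) b z - b z * dirDeriv (spaceDir j) a z)) := by
    refine Finset.sum_nonneg fun j _ => mul_nonneg (by positivity) ?_
    generalize a z * dirDeriv (spaceDir j) a z + b z * dirDeriv (spaceDir j) b z = A
    generalize a z * dirDeriv (spaceDir j) b z - b z * dirDeriv (spaceDir j) a z = B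
    have h1 := mul_nonneg hκ.le (sq_nonneg (A - B))
    have h2 : 0 ≤ (σ - 6 * κ) * (A ^ 2 + B ^ 2) := mul_nonneg (by linarith) (by positivity)
    nlinarith [mul_nonneg hσ.le (sq_nonneg A)]
  have hdiss := dissipation_nonpos hσ hκ hV0 hat hbt
  simp only [Finset.sum_add_distrib, ← Finset.mul_sum] at hquad ⊢
  linarith

lemma sd_eq_dirDeriv {u : ℝ → EuclideanSpace ℝ (Fin d) → ℂ}
    (hu : Differentiable ℝ (Function.uncurry u)) (t : ℝ) (j : Fin d) :
    sd (u t) j = fun x => dirDeriv (spaceDir j) (Function.uncurry u) (t, x) :=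
  funext fun x => fderiv_slice hu t x _

lemma lap_eq_sum_dirDeriv {u : ℝ → EuclideanSpace ℝ (Fin d) → ℂ}
    (hu : ContDiff ℝ (⊤ : ℕ∞) (Function.uncurry u)) (t : ℝ) (x : EuclideanSpace ℝ (Fin d)) :
    lap (u t) x =
      ∑ j, dirDeriv (spaceDir j) (dirDeriv (spaceDir j) (Function.uncurry u)) (t, x) := by
  refine Finset.sum_congr rfl fun j _ => ?_
  rw [sd_eq_dirDeriv (hu.differentiable (by simp))]
  exact fderiv_slice ((contDiff_dirDeriv hu _).differentiable (by simp)) t x _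

lemma dirDeriv_re {X : Type*} [NormedAddCommGroup X] [NormedSpace ℝ X] {f : X → ℂ}
    (hf : ContDiff ℝ (⊤ : ℕ∞) f) (v : X) :
    dirDeriv v (fun y => (f y).re) = fun z => (dirDeriv v f z).re :=
  funext fun z => dirDeriv_clm_comp (hf.differentiable (by simp)) Complex.reCLM v z

lemma dirDeriv_im {X : Type*} [NormedAddCommGroup X] [NormedSpace ℝ X] {f : X → ℂ}
    (hf : ContDiff ℝ (⊤ : ℕ∞) f) (v : X) :
    dirDeriv v (fun y => (f y).im) = fun z => (dirDeriv v f z).im :=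
  funext fun z => dirDeriv_clm_comp (hf.differentiable (by simp)) Complex.imCLM v z

lemma norm_sq_eq_re_sq_add_im_sq (w : ℂ) : ‖w‖ ^ 2 = w.re ^ 2 + w.im ^ 2 := by
  rw [Complex.sq_norm, Complex.normSq_apply]; ring

lemma energyDensity_re_im {u : ℝ → EuclideanSpace ℝ (Fin d) → ℂ}
    (hu : ContDiff ℝ (⊤ : ℕ∞) (Function.uncurry u)) (t : ℝ) (x : EuclideanSpace ℝ (Fin d)) :
    energyDensity lam κ q (fun y => (Function.uncurry u y).re)
      (fun y => (Function.uncurry u y).im) (t, x) =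
    1 / 2 * ∑ j, ‖sd (u t) j x‖ ^ 2 + q (t, x) * ‖u t x‖ ^ 2 + lam / 2 * ‖u t x‖ ^ 4
      + κ * ‖u t x‖ ^ 6 := by
  rw [show ‖u t x‖ ^ 4 = (‖u t x‖ ^ 2) ^ 2 by ring, show ‖u t x‖ ^ 6 = (‖u t x‖ ^ 2) ^ 3 by ring]
  simp only [energyDensity, dirDeriv_re hu, dirDeriv_im hu,
    sd_eq_dirDeriv (hu.differentiable (by simp)), norm_sq_eq_re_sq_add_im_sq, Function.uncurry_apply_pair]

/-- The energy augmented by `λ²/(12κ)` times the mass is nonincreasing along solutions. -/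
lemma IsSol.antitoneOn_energy {V : EuclideanSpace ℝ (Fin d) → ℝ}
    {u : ℝ → EuclideanSpace ℝ (Fin d) → ℂ} (hσ : 0 < σ) (hκ : 0 < κ) (hκσ : κ < σ / 6)
    (hV : ContDiff ℝ (⊤ : ℕ∞) V) (hV0 : ∀ x, 0 ≤ V x) (hu : IsSol d 5 σ lam V u) :
    AntitoneOn (fun t => ∫ x, (1 / 2 * ∑ j, ‖sd (u t) j x‖ ^ 2
      + (V x + lam ^ 2 / (12 * κ)) * ‖u t x‖ ^ 2 + lam / 2 * ‖u t x‖ ^ 4 + κ * ‖u t x‖ ^ 6))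
      (Ici 0) := by
  obtain ⟨hW, heq, K, hK, hK0⟩ := hu
  have hd := hW.differentiable (by simp)
  have ha : ContDiff ℝ (⊤ : ℕ∞) fun y => (Function.uncurry u y).re :=
    Complex.reCLM.contDiff.comp hW
  have hb : ContDiff ℝ (⊤ : ℕ∞) fun y => (Function.uncurry u y).im :=
    Complex.imCLM.contDiff.comp hW
  have ha0 : VanishesOutside K fun y => (Function.uncurry u y).re :=
    fun z hz hzK => by simp [Function.uncurry, hK0 z.1 hz z.2 hzK]
  have hb0 : VanishesOutside K fun y => (Function.uncurry u y).im :=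
    fun z hz hzK => by simp [Function.uncurry, hK0 z.1 hz z.2 hzK]
  have ha0' := ha0.dirDeriv hK.isClosed ha
  have hb0' := hb0.dirDeriv hK.isClosed hb
  simp only [← energyDensity_re_im (q := fun y => V y.2 + lam ^ 2 / (12 * κ)) hW]
  refine VanishesOutside.antitoneOn_integral hK
    (J := energyFlux σ κ (lam ^ 2 / (12 * κ)) (fun y => (Function.uncurry u y).re)
      fun y => (Function.uncurry u y).im)
    (contDiff_energyDensity (by fun_prop) ha hb) ?_ (contDiff_energyFlux ha hb) ?_
    (fun j => EuclideanSpace.single j 1) ?_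
  · intro z hz hzK
    have h1 := ha0 z hz hzK
    have h2 := hb0 z hz hzK
    simp only at h1 h2
    simp [energyDensity, h1, h2, ha0' _ z hz hzK, hb0' _ z hz hzK]
  · intro j z hz hzK
    simp [energyFlux, ha0' _ z hz hzK, hb0' _ z hz hzK]
  · intro t x ht
    have h := heq t ht x
    rw [lap_eq_sum_dirDeriv hW, show deriv (fun s => u s x) t = _ from
      (hasDerivAt_time hd t x).deriv, show (5 : ℝ) - 1 = (4 : ℕ) by norm_num,
      Real.rpow_natCast, show ‖u t x‖ ^ 4 = (‖u t x‖ ^ 2) ^ 2 by ring,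
      norm_sq_eq_re_sq_add_im_sq] at h
    have hre := congrArg Complex.re h
    have him := congrArg Complex.im h
    simp [-Complex.ofReal_add, -Complex.ofReal_pow] at hre him
    refine dirDeriv_time_energyDensity_le hσ hκ hκσ hV ha hb (t, x) (hV0 x) ?_ ?_ <;>
    simp only [dirDeriv_re hW, dirDeriv_im hW, dirDeriv_re (contDiff_dirDeriv hW _),
      dirDeriv_im (contDiff_dirDeriv hW _), Function.uncurry_apply_pair] <;>
    linarith

end DampedNLS

/-- for `d = 3`, `p = 5`, `σ > 0`, `0 < κ < σ/6`, a quadratic potential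
`V(x) = (1/2) Σ_j ω_j² x_j²`, and a classical compactly supported solution `u` of the
damped NLS, one has for all `t ≥ 0` the uniform bound
`‖∇u(t)‖_{L²}² + 2∫V|u(t)|² ≤ 2E_κ(0) + (7λ²/(24κ))‖u(0)‖_{L²}²`,
where `E_κ(t) = ∫ (1/2)|∇u|² + V|u|² + (λ/2)|u|⁴ + κ|u|⁶`. -/
theorem stmt10 (σ lam κ : ℝ) (hσ : 0 < σ) (hκ : 0 < κ) (hκσ : κ < σ / 6)
    (ω : Fin 3 → ℝ)
    (V : EuclideanSpace ℝ (Fin 3) → ℝ)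
    (hV : ∀ x, V x = (1 / 2) * ∑ j, (ω j) ^ 2 * (x j) ^ 2)
    (u : ℝ → EuclideanSpace ℝ (Fin 3) → ℂ)
    (hu : IsSol 3 5 σ lam V u) :
    ∀ t ≥ (0 : ℝ),
      (∫ x, ∑ j, ‖sd (u t) j x‖ ^ 2) + 2 * ∫ x, V x * ‖u t x‖ ^ 2
        ≤ 2 * (∫ x, ((1 / 2) * ∑ j, ‖sd (u 0) j x‖ ^ 2 + V x * ‖u 0 x‖ ^ 2
              + (lam / 2) * ‖u 0 x‖ ^ 4 + κ * ‖u 0 x‖ ^ 6))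
          + (7 * lam ^ 2 / (24 * κ)) * ∫ x, ‖u 0 x‖ ^ 2 := by
  intro t ht
  have hVc : ContDiff ℝ (⊤ : ℕ∞) V := by
    rw [funext hV]
    fun_prop
  have hV0 (x) : 0 ≤ V x := by
    rw [hV]
    positivity
  have hanti := hu.antitoneOn_energy hσ hκ hκσ hVc hV0 self_mem_Ici ht ht
  obtain ⟨hW, -, K, hK, hK0⟩ := hu
  have hW0 : VanishesOutside K (Function.uncurry u) := fun z hz hzK => hK0 z.1 hz z.2 hzK
  have hint {f : ℝ × EuclideanSpace ℝ (Fin 3) → ℝ} (hf : Continuous f)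
      (hf0 : VanishesOutside K f) {s : ℝ} (hs : 0 ≤ s) : Integrable fun x => f (s, x) :=
    hf0.integrable_slice hK hf hs
  have hu_cont : Continuous fun z : ℝ × EuclideanSpace ℝ (Fin 3) => u z.1 z.2 := hW.continuous
  have hsd_cont (j : Fin 3) :
      Continuous fun z : ℝ × EuclideanSpace ℝ (Fin 3) => sd (u z.1) j z.2 := by
    simp only [sd_eq_dirDeriv (hW.differentiable (by simp))]
    exact (contDiff_dirDeriv hW _).continuous
  have hsd0 (j : Fin 3) {s : ℝ} (hs : 0 ≤ s) {x} (hx : x ∉ K) : sd (u s) j x = 0 := by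
    simp only [sd_eq_dirDeriv (hW.differentiable (by simp))]
    exact hW0.dirDeriv hK.isClosed hW _ (s, x) hs hx
  have hV_cont := hVc.continuous
  have hgrad {s : ℝ} (hs : 0 ≤ s) : Integrable fun x => ∑ j, ‖sd (u s) j x‖ ^ 2 :=
    hint (f := fun z => ∑ j, ‖sd (u z.1) j z.2‖ ^ 2) (by fun_prop)
      (fun z hz hzK => by simp [hsd0 _ hz hzK]) hs
  have hmul {g : EuclideanSpace ℝ (Fin 3) → ℝ} (hg : Continuous g) {n : ℕ} (hn : n ≠ 0) {s : ℝ}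
      (hs : 0 ≤ s) : Integrable fun x => g x * ‖u s x‖ ^ n :=
    hint (f := fun z => g z.2 * ‖u z.1 z.2‖ ^ n) (by fun_prop)
      (fun z hz hzK => by simp [hK0 _ hz _ hzK, hn]) hs
  have hmass : Integrable fun x => ‖u 0 x‖ ^ 2 := by
    simpa using hmul (continuous_const (y := (1 : ℝ))) two_ne_zero le_rfl
  have henergy (g : EuclideanSpace ℝ (Fin 3) → ℝ) (hg : Continuous g) {s : ℝ} (hs : 0 ≤ s) :
      Integrable fun x => 1 / 2 * ∑ j, ‖sd (u s) j x‖ ^ 2 + g x * ‖u s x‖ ^ 2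
        + lam / 2 * ‖u s x‖ ^ 4 + κ * ‖u s x‖ ^ 6 :=
    ((((hgrad hs).const_mul _).add (hmul hg two_ne_zero hs)).add
      (hmul continuous_const four_ne_zero hs)).add (hmul continuous_const (by norm_num) hs)
  have hinit : ∫ x, (1 / 2 * ∑ j, ‖sd (u 0) j x‖ ^ 2
      + (V x + lam ^ 2 / (12 * κ)) * ‖u 0 x‖ ^ 2 + lam / 2 * ‖u 0 x‖ ^ 4 + κ * ‖u 0 x‖ ^ 6)
      = (∫ x, (1 / 2 * ∑ j, ‖sd (u 0) j x‖ ^ 2 + V x * ‖u 0 x‖ ^ 2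
        + lam / 2 * ‖u 0 x‖ ^ 4 + κ * ‖u 0 x‖ ^ 6))
        + lam ^ 2 / (12 * κ) * ∫ x, ‖u 0 x‖ ^ 2 := by
    rw [← integral_const_mul, ← integral_add (henergy V hV_cont le_rfl) (hmass.const_mul _)]
    congr 1 with x
    ring
  have hlower : (∫ x, ∑ j, ‖sd (u t) j x‖ ^ 2) + 2 * ∫ x, V x * ‖u t x‖ ^ 2
      ≤ 2 * ∫ x, (1 / 2 * ∑ j, ‖sd (u t) j x‖ ^ 2
      + (V x + lam ^ 2 / (12 * κ)) * ‖u t x‖ ^ 2 + lam / 2 * ‖u t x‖ ^ 4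
      + κ * ‖u t x‖ ^ 6) := by
    rw [← integral_const_mul, ← integral_const_mul,
      ← integral_add (hgrad ht) ((hmul hV_cont two_ne_zero ht).const_mul 2)]
    refine integral_mono ((hgrad ht).add ((hmul hV_cont two_ne_zero ht).const_mul 2))
      ((henergy (fun x => V x + lam ^ 2 / (12 * κ)) (by fun_prop) ht).const_mul 2) fun x => ?_
    have hsq : 2 * (lam ^ 2 / (12 * κ) * ‖u t x‖ ^ 2 + lam / 2 * ‖u t x‖ ^ 4 + κ * ‖u t x‖ ^ 6)
        = 2 * κ * ‖u t x‖ ^ 2 * ((‖u t x‖ ^ 2 + lam / (4 * κ)) ^ 2 + lam ^ 2 / (48 * κ ^ 2)) := by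
      field_simp
      ring
    have hpos : 0 ≤ 2 * κ * ‖u t x‖ ^ 2 *
        ((‖u t x‖ ^ 2 + lam / (4 * κ)) ^ 2 + lam ^ 2 / (48 * κ ^ 2)) := by positivity
    simp only
    linarith
  have hconst : 2 * (lam ^ 2 / (12 * κ)) * ∫ x, ‖u 0 x‖ ^ 2
      ≤ 7 * lam ^ 2 / (24 * κ) * ∫ x, ‖u 0 x‖ ^ 2 := by
    refine mul_le_mul_of_nonneg_right ?_ (integral_nonneg fun x => by positivity)
    have hdiff : 7 * lam ^ 2 / (24 * κ) - 2 * (lam ^ 2 / (12 * κ)) = lam ^ 2 / (8 * κ) := by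
      field_simp
      ring
    have hpos : 0 ≤ lam ^ 2 / (8 * κ) := by positivity
    linarith
  simp only at hanti
  linarith
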